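/- arXiv:math/0109210 — 2 statements merged into one kernel-verified Lean document; each statement's English description precedes it below -/
import Mathlib

section
/- Let l ≥ 4. Let C be the (symmetric) Cartan matrix of type D_l and let C̃ be the affine Cartan matrix of type D_l^{(1)} (size l+1). Define simple reflections by s_i(e_j) = e_j − c_{ij} e_i in the respective standard bases, let c = s₁s₂⋯s_l be a Coxeter element, and let c_a = s₀s₁⋯s_l be an affine Coxeter element (any fixed order of the factors; for these tree diagrams the characteristic polynomial does not depend on the order). Then det(t·I − c) = (t^{l−1} + 1)(t + 1), det(t·I − c_a) = (t + 1)²(t − 1)(t^{l−2} − 1)/(t−1)·(t−1) — explicitly, det(t·I − c_a)·(t − 1) = (t² − 1)²(t^{l−2} − 1) — and consequently the Poincaré series p(t) = (1−t^{2(l−1)})/((1−t²)(1−t^{l−2})(1−t^{l−1})) of the Kleinian singularity of type D_l satisfies p(t) = det(t·I − c)/det(t·I − c_a) as rational functions. -/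
open Polynomial

/-- The simple reflection `s_i` associated to a (generalized) Cartan matrix `C`,
acting on the standard basis by `s_i(e_j) = e_j - c_{ij} e_i`. -/
def simpleRefl {N : ℕ} (C : Matrix (Fin N) (Fin N) ℚ) (i : Fin N) :
    Matrix (Fin N) (Fin N) ℚ :=
  Matrix.of fun k j => (if k = j then 1 else 0) - (if k = i then C i j else 0)

/-- The Cartan matrix of type `D_l` (`l ≥ 4`), with `0`-based indices: a chain
`0 — 1 — ⋯ — (l-2)` together with an extra edge `(l-3) — (l-1)`. -/
def cartanD (l : ℕ) : Matrix (Fin l) (Fin l) ℚ :=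
  Matrix.of fun i j =>
    if i = j then 2
    else if (i.val + 1 = j.val ∧ j.val ≤ l - 2) ∨ (j.val + 1 = i.val ∧ i.val ≤ l - 2)
      ∨ (i.val = l - 3 ∧ j.val = l - 1) ∨ (j.val = l - 3 ∧ i.val = l - 1)
    then -1 else 0

/-- Adjacency for the affine diagram `D_l^{(1)}` on vertices `0, …, l`: edges
`{0,2}`, `{1,2}`, `{k,k+1}` for `2 ≤ k ≤ l-3`, `{l-2,l-1}` and `{l-2,l}`. -/
def adjDAffine (l : ℕ) (i j : ℕ) : Prop :=
  (i = 0 ∧ j = 2) ∨ (i = 1 ∧ j = 2) ∨ (i + 1 = j ∧ 2 ≤ i ∧ j ≤ l - 2)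
    ∨ (i = l - 2 ∧ j = l - 1) ∨ (i = l - 2 ∧ j = l)

instance (l i j : ℕ) : Decidable (adjDAffine l i j) := by unfold adjDAffine; infer_instance

/-- The affine Cartan matrix of type `D_l^{(1)}` (size `l+1`). -/
def cartanDAffine (l : ℕ) : Matrix (Fin (l + 1)) (Fin (l + 1)) ℚ :=
  Matrix.of fun i j =>
    if i = j then 2
    else if adjDAffine l i.val j.val ∨ adjDAffine l j.val i.val then -1 else 0

/-- A matrix that is upper triangular for the order pulled back along an injection has the product
of its diagonal entries as determinant. -/
theorem Matrix.BlockTriangular.det_of_injective {ι α R : Type*} [Fintype ι] [DecidableEq ι]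
    [LinearOrder α] [CommRing R] {M : Matrix ι ι R} {h : ι → α} (hM : M.BlockTriangular h)
    (hinj : Function.Injective h) : M.det = ∏ i, M i i := by
  let := LinearOrder.lift' h hinj
  exact Matrix.det_of_isUpperTriangular fun i j hij => hM hij

/-- The unitriangular matrix `1 + N`, where `N` is the part of `A` strictly above the diagonal
for the order of the indices given by `σ`. -/
def unitUpper {N : ℕ} (A : Matrix (Fin N) (Fin N) ℚ) (σ : Equiv.Perm (Fin N)) :
    Matrix (Fin N) (Fin N) ℚ :=
  Matrix.of fun i j => (if i = j then 1 else 0) + (if σ.symm i < σ.symm j then A i j else 0)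

theorem det_unitUpper {N : ℕ} (A : Matrix (Fin N) (Fin N) ℚ) (σ : Equiv.Perm (Fin N)) :
    (unitUpper A σ).det = 1 := by
  have h : (unitUpper A σ).BlockTriangular σ.symm := by
    intro i j hij
    have hne : i ≠ j := by rintro rfl; exact lt_irrefl _ hij
    simp [unitUpper, hne, hij.le]
  rw [h.det_of_injective σ.symm.injective]
  simp [unitUpper]

theorem mul_simpleRefl_apply {N : ℕ} (A B : Matrix (Fin N) (Fin N) ℚ) (m i j : Fin N) :
    (B * simpleRefl A m) i j = B i j - B i m * A m j := by
  simp [Matrix.mul_apply, simpleRefl, mul_sub, Finset.sum_sub_distrib]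

theorem unitUpper_mul_take_prod {N : ℕ} (A : Matrix (Fin N) (Fin N) ℚ) (σ : Equiv.Perm (Fin N))
    (k : ℕ) (hk : k ≤ N) (i j : Fin N) :
    (unitUpper A σ * ((List.ofFn fun k => simpleRefl A (σ k)).take k).prod) i j =
      unitUpper A σ i j - if (σ.symm i).val < k then A i j else 0 := by
  induction k generalizing j with
  | zero => simp
  | succ k ih =>
    have hk' : k < N := hk
    rw [List.prod_take_succ _ _ (by simpa using hk'), ← Matrix.mul_assoc, List.getElem_ofFn,
      mul_simpleRefl_apply, ih hk'.le, ih hk'.le]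
    by_cases hi : i = σ ⟨k, hk'⟩
    · subst hi
      simp [unitUpper]
    · have hne : (σ.symm i).val ≠ k := fun h => hi (by
        rw [← σ.apply_symm_apply i]; congr 1; exact Fin.ext h)
      have hiff : (σ.symm i).val < k + 1 ↔ (σ.symm i).val < k := by omega
      rcases lt_or_ge (σ.symm i).val k with hlt | hge
      · simp [unitUpper, hi, hiff, Fin.lt_def, hlt, -Fin.val_fin_lt]
      · simp [unitUpper, hi, hiff, Fin.lt_def, hge.not_gt, -Fin.val_fin_lt]

/-- If `U` is the unitriangular part of `A` for the order of the factors, the Coxeter element `c`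
satisfies `U c = U - A`. -/
theorem unitUpper_mul_prod {N : ℕ} (A : Matrix (Fin N) (Fin N) ℚ) (σ : Equiv.Perm (Fin N)) :
    unitUpper A σ * (List.ofFn fun k => simpleRefl A (σ k)).prod = unitUpper A σ - A := by
  ext i j
  have h := unitUpper_mul_take_prod A σ N le_rfl i j
  rw [List.take_of_length_le (by simp)] at h
  simpa using h

theorem charpoly_prod_simpleRefl {N : ℕ} (A : Matrix (Fin N) (Fin N) ℚ) (hA : ∀ i, A i i = 2)
    (σ : Equiv.Perm (Fin N)) :
    (List.ofFn fun k => simpleRefl A (σ k)).prod.charpoly =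
      (Matrix.of fun i j => if i = j then X + 1
        else (if σ.symm i < σ.symm j then X else 1) * C (A i j)).det := by
  have hdet : (C.mapMatrix (unitUpper A σ)).det = 1 := by
    rw [← RingHom.map_det, det_unitUpper, map_one]
  have hmul := Matrix.det_mul (C.mapMatrix (unitUpper A σ))
    (Matrix.charmatrix (List.ofFn fun k => simpleRefl A (σ k)).prod)
  rw [hdet, one_mul] at hmul
  rw [Matrix.charpoly, ← hmul]
  congr 1
  rw [Matrix.charmatrix, mul_sub, ← map_mul, unitUpper_mul_prod]
  ext1 i j
  rw [Matrix.sub_apply, Matrix.scalar_apply, Matrix.mul_diagonal]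
  by_cases hij : i = j
  · subst hij
    simp only [RingHom.mapMatrix_apply, Matrix.map_apply, Matrix.sub_apply, unitUpper,
      Matrix.of_apply, hA, if_true, lt_irrefl, if_false]
    norm_num
  · by_cases hlt : σ.symm i < σ.symm j
    · simp [unitUpper, hij, hlt]
    · simp [unitUpper, hij, hlt]

/-- Determinant of a matrix supported on a rooted forest, by elimination from the leaves:
`P k i` says that `i` is the parent of `k`, and the `d i` are the pivots. -/
theorem det_eq_prod_pivots {ι K : Type*} [Fintype ι] [DecidableEq ι] [Field K]
    (P : ι → ι → Prop) [DecidableRel P] (h : ι → ℕ) (hinj : Function.Injective h)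
    (hP : ∀ k i, P k i → h i < h k) (hfun : ∀ k i j, P k i → P k j → i = j)
    (M : Matrix ι ι K) (d : ι → K) (hd : ∀ k i, P k i → d k ≠ 0)
    (hoff : ∀ i j, i ≠ j → ¬P i j → ¬P j i → M i j = 0)
    (hdiag : ∀ i, M i i = d i + ∑ k, if P k i then M i k * M k i / d k else 0) :
    M.det = ∏ i, d i := by
  have hirr (i : ι) : ¬P i i := fun hi => lt_irrefl _ (hP i i hi)
  set A : Matrix ι ι K := Matrix.of fun i k => if P k i then M i k / d k else 0 with hA
  set B : Matrix ι ι K := Matrix.of fun k j => if P k j then M k j else 0 with hB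
  have hAB (i j : ι) : (A * B) i j =
      if i = j then ∑ k, if P k i then M i k * M k i / d k else 0 else 0 := by
    rw [Matrix.mul_apply]
    split_ifs with hij
    · subst hij
      refine Finset.sum_congr rfl fun k _ => ?_
      by_cases hk : P k i
      · simp [hA, hB, hk, div_mul_eq_mul_div]
      · simp [hA, hk]
    · refine Finset.sum_eq_zero fun k _ => ?_
      by_cases h1 : P k i
      · have h2 : ¬P k j := fun h2 => hij (hfun k i j h1 h2)
        simp [hB, h2]
      · simp [hA, h1]
  have hLW : M = (1 + A) * (Matrix.diagonal d + B) := by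
    ext i j
    rw [add_mul, mul_add, mul_add, one_mul, one_mul]
    simp only [Matrix.add_apply, Matrix.mul_diagonal, hAB]
    by_cases hij : i = j
    · subst hij
      simp [hA, hB, hirr, ← hdiag i]
    · by_cases h1 : P j i
      · have h2 : ¬P i j := fun h2 => (hP j i h1).asymm (hP i j h2)
        simp [hA, hB, hij, h1, h2, div_mul_cancel₀ _ (hd j i h1)]
      · by_cases h2 : P i j
        · simp [hA, hB, hij, h1, h2]
        · simp [hA, hB, hij, h1, h2, hoff i j hij h2 h1]
  have hLt : (1 + A).BlockTriangular h := by
    intro i j hij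
    have h1 : i ≠ j := by rintro rfl; exact lt_irrefl _ hij
    have h2 : ¬P j i := fun hp => hij.asymm (hP j i hp)
    simp [hA, h1, h2]
  have hWt : (Matrix.diagonal d + B).BlockTriangular (OrderDual.toDual ∘ h) := by
    intro i j hij
    have hij' : h i < h j := hij
    have h1 : i ≠ j := by rintro rfl; exact lt_irrefl _ hij
    have h2 : ¬P i j := fun hp => hij'.asymm (hP i j hp)
    simp [hB, h1, h2]
  rw [hLW, Matrix.det_mul, hLt.det_of_injective hinj,
    hWt.det_of_injective (OrderDual.toDual.injective.comp hinj)]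
  simp [hA, hB, hirr]

/-- The characteristic polynomial of a Coxeter element of a forest, as the product of the pivots
`d i` of the elimination from the leaves. -/
theorem algebraMap_charpoly_eq_prod_pivots {N : ℕ} (A : Matrix (Fin N) (Fin N) ℚ)
    (σ : Equiv.Perm (Fin N)) (P : Fin N → Fin N → Prop) [DecidableRel P] (h : Fin N → ℕ)
    (hinj : Function.Injective h) (hP : ∀ k i, P k i → h i < h k)
    (hfun : ∀ k i j, P k i → P k j → i = j)
    (hA : ∀ i j, A i j = if i = j then 2 else if P i j ∨ P j i then -1 else 0)
    (d : Fin N → RatFunc ℚ) (hd : ∀ k i, P k i → d k ≠ 0)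
    (hsum : ∀ i, RatFunc.X + 1 = d i + ∑ k, if P k i then RatFunc.X / d k else 0) :
    algebraMap ℚ[X] (RatFunc ℚ) (List.ofFn fun k => simpleRefl A (σ k)).prod.charpoly =
      ∏ i, d i := by
  rw [charpoly_prod_simpleRefl A (fun i => by simp [hA]), RingHom.map_det]
  refine det_eq_prod_pivots P h hinj hP hfun _ d hd (fun i j hij h1 h2 => ?_) fun i => ?_
  · simp [hA, hij, h1, h2]
  · simp only [RingHom.mapMatrix_apply, Matrix.map_apply, Matrix.of_apply, if_true, map_add,
      RatFunc.algebraMap_X, map_one]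
    rw [hsum i]
    congr 1
    refine Finset.sum_congr rfl fun k _ => ?_
    by_cases hk : P k i
    · have hne : i ≠ k := by rintro rfl; exact lt_irrefl _ (hP _ _ hk)
      have hs : σ.symm i ≠ σ.symm k := fun h => hne (σ.symm.injective h)
      rcases hs.lt_or_gt with hlt | hlt
      · simp [hk, hA, hne, hne.symm, hlt, hlt.asymm]
      · simp [hk, hA, hne, hne.symm, hlt, hlt.asymm]
    · simp [hk]

theorem prod_range_div_of_ne_zero {K : Type*} [Field K] (f : ℕ → K) (hf : ∀ i, f i ≠ 0) (n : ℕ) :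
    ∏ i ∈ Finset.range n, f i / f (i + 1) = f 0 / f n := by
  induction n with
  | zero => simp [hf 0]
  | succ n ih => rw [Finset.prod_range_succ, ih, div_mul_div_cancel₀ (hf n)]

theorem ratFunc_X_pow_add_one_ne_zero (n : ℕ) : (RatFunc.X ^ n + 1 : RatFunc ℚ) ≠ 0 := by
  have h : (X ^ n + 1 : ℚ[X]) ≠ 0 := fun h => by
    have := congrArg (Polynomial.eval 1) h
    norm_num at this
  simpa using (map_ne_zero_iff (algebraMap ℚ[X] (RatFunc ℚ))
    (IsFractionRing.injective ℚ[X] (RatFunc ℚ))).2 h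

theorem ratFunc_X_pow_sub_one_ne_zero {n : ℕ} (hn : n ≠ 0) :
    (RatFunc.X ^ n - 1 : RatFunc ℚ) ≠ 0 := by
  have h : (X ^ n - 1 : ℚ[X]) ≠ 0 := (monic_X_pow_sub_C (1 : ℚ) hn).ne_zero
  simpa using (map_ne_zero_iff (algebraMap ℚ[X] (RatFunc ℚ))
    (IsFractionRing.injective ℚ[X] (RatFunc ℚ))).2 h

theorem charpoly_coxeter_D (m : ℕ) (σ : Equiv.Perm (Fin (m + 4))) :
    algebraMap ℚ[X] (RatFunc ℚ)
        (List.ofFn fun k => simpleRefl (cartanD (m + 4)) (σ k)).prod.charpoly =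
      (RatFunc.X ^ (m + 3) + 1) * (RatFunc.X + 1) := by
  set f : ℕ → RatFunc ℚ := fun i => RatFunc.X ^ (m + 3 - i) + 1 with hf
  have hf0 (i : ℕ) : f i ≠ 0 := ratFunc_X_pow_add_one_ne_zero _
  have h1 : (RatFunc.X + 1 : RatFunc ℚ) ≠ 0 := by simpa using ratFunc_X_pow_add_one_ne_zero 1
  set d : ℕ → RatFunc ℚ := fun i => if i < m + 2 then f i / f (i + 1) else RatFunc.X + 1 with hd
  have hd0 (i : ℕ) : d i ≠ 0 := by
    simp only [hd]
    split_ifs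
    exacts [div_ne_zero (hf0 _) (hf0 _), h1]
  rw [algebraMap_charpoly_eq_prod_pivots _ σ
    (fun k i => (i.val + 1 = k.val ∧ k.val ≤ m + 2) ∨ (i.val = m + 1 ∧ k.val = m + 3))
    Fin.val Fin.val_injective (by omega) (by omega) ?_ (fun i => d i) (fun k _ _ => hd0 k)
    (fun i => ?_)]
  · rw [Fin.prod_univ_eq_prod_range (fun i => d i), Finset.prod_range_succ, Finset.prod_range_succ,
      Finset.prod_congr rfl (g := fun i => f i / f (i + 1)), prod_range_div_of_ne_zero f hf0]
    · simp only [hd, hf, lt_irrefl, if_false]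
      simp [div_mul_cancel₀ _ h1]
    · intro i hi
      simp [hd, Finset.mem_range.1 hi]
  · intro i j
    simp only [cartanD, Matrix.of_apply]
    congr 2
    apply propext
    omega
  · rw [Fin.sum_univ_eq_sum_range (fun k => if (i.val + 1 = k ∧ k ≤ m + 2) ∨
      (i.val = m + 1 ∧ k = m + 3) then RatFunc.X / d k else 0)]
    obtain ⟨i, hi⟩ := i
    simp only
    rw [← Finset.sum_filter]
    rcases lt_trichotomy i (m + 1) with h | rfl | h
    · have : (Finset.range (m + 4)).filter (fun k => (i + 1 = k ∧ k ≤ m + 2) ∨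
          (i = m + 1 ∧ k = m + 3)) = {i + 1} := by
        ext k; simp; omega
      rw [this, Finset.sum_singleton]
      obtain ⟨e, rfl⟩ : ∃ e, m = i + e := ⟨m - i, by omega⟩
      have e0 := hf0 i
      have e1 := hf0 (i + 1)
      have e2 := hf0 (i + 1 + 1)
      rw [hd]
      simp only [show i < i + e + 2 by omega, show i + 1 < i + e + 2 by omega, if_true]
      field_simp
      simp only [hf, show i + e + 3 - i = e + 3 by omega, show i + e + 3 - (i + 1) = e + 2 by omega,
        show i + e + 3 - (i + 1 + 1) = e + 1 by omega]
      ring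
    · have : (Finset.range (m + 4)).filter (fun k => (m + 1 + 1 = k ∧ k ≤ m + 2) ∨
          (m + 1 = m + 1 ∧ k = m + 3)) = {m + 2, m + 3} := by
        ext k; simp; omega
      rw [this, Finset.sum_pair (by omega)]
      simp [hd, hf, show m + 3 - (m + 1) = 2 by omega]
      field_simp
      ring
    · have : (Finset.range (m + 4)).filter (fun k => (i + 1 = k ∧ k ≤ m + 2) ∨
          (i = m + 1 ∧ k = m + 3)) = ∅ := by
        ext k; simp; omega
      rw [this, Finset.sum_empty]
      simp [hd, show ¬ i < m + 2 by omega]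

theorem charpoly_coxeter_D_affine (m : ℕ) (τ : Equiv.Perm (Fin (m + 4 + 1))) :
    algebraMap ℚ[X] (RatFunc ℚ)
        (List.ofFn fun k => simpleRefl (cartanDAffine (m + 4)) (τ k)).prod.charpoly =
      (RatFunc.X + 1) ^ 2 * (RatFunc.X - 1) * (RatFunc.X ^ (m + 2) - 1) := by
  set f : ℕ → RatFunc ℚ := fun i => RatFunc.X ^ (m + 4 - i) + 1 with hf
  have hf0 (i : ℕ) : f i ≠ 0 := ratFunc_X_pow_add_one_ne_zero _
  have h1 : (RatFunc.X + 1 : RatFunc ℚ) ≠ 0 := by simpa using ratFunc_X_pow_add_one_ne_zero 1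
  set d : ℕ → RatFunc ℚ := fun i =>
    if i = 2 then (RatFunc.X - 1) * (RatFunc.X ^ (m + 2) - 1) / ((RatFunc.X + 1) * f 3)
    else if 3 ≤ i ∧ i < m + 3 then f i / f (i + 1) else RatFunc.X + 1 with hd
  have hd0 (i : ℕ) (hi : i ≠ 2) : d i ≠ 0 := by
    simp only [hd, hi, if_false]
    split_ifs
    exacts [div_ne_zero (hf0 _) (hf0 _), h1]
  have hleaf (i : ℕ) (hi : i < 2 ∨ m + 3 ≤ i) : d i = RatFunc.X + 1 := by
    simp only [hd]
    rw [if_neg (by omega), if_neg (by omega)]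
  have hchain (i : ℕ) (h3 : 3 ≤ i) (hi : i < m + 3) : d i = f i / f (i + 1) := by
    simp only [hd]
    rw [if_neg (by omega), if_pos ⟨h3, hi⟩]
  have hroot : d 2 =
      (RatFunc.X - 1) * (RatFunc.X ^ (m + 2) - 1) / ((RatFunc.X + 1) * f 3) := by
    simp [hd]
  rw [algebraMap_charpoly_eq_prod_pivots _ τ
    (fun k i => (i.val = 2 ∧ k.val < 2) ∨ (2 ≤ i.val ∧ i.val + 1 = k.val ∧ k.val ≤ m + 3) ∨
      (i.val = m + 2 ∧ k.val = m + 4))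
    (fun i => if i.val < 2 then m + 5 + i.val else i.val) ?_ ?_ (by omega) ?_ (fun i => d i)
    (fun k _ hk => hd0 k (by omega)) (fun i => ?_)]
  · rw [Fin.prod_univ_eq_prod_range (fun i => d i), Finset.prod_range_succ, Finset.prod_range_succ,
      show m + 3 = 3 + m by omega, Finset.prod_range_add,
      Finset.prod_congr rfl (g := fun i => f (3 + i) / f (3 + (i + 1))) fun i hi =>
        hchain (3 + i) (by omega) (by have := Finset.mem_range.1 hi; omega),
      prod_range_div_of_ne_zero (fun i => f (3 + i)) fun i => hf0 (3 + i), Finset.prod_range_succ,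
      Finset.prod_range_succ,
      Finset.prod_range_one, hroot, hleaf 0 (by omega), hleaf 1 (by omega),
      hleaf (3 + m) (by omega), hleaf (m + 4) (by omega)]
    have e3 := hf0 3
    have em : f (3 + m) = RatFunc.X + 1 := by
      simp [hf, show m + 4 - (3 + m) = 1 by omega]
    rw [em, add_zero]
    field_simp
  · intro i j hij
    apply Fin.ext
    beta_reduce at hij
    split_ifs at hij <;> omega
  · intro k i hk
    split_ifs <;> omega
  · intro i j
    simp only [cartanDAffine, adjDAffine, Matrix.of_apply]
    congr 2
    apply propext
    omega
  · rw [Fin.sum_univ_eq_sum_range (fun k => if (i.val = 2 ∧ k < 2) ∨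
      (2 ≤ i.val ∧ i.val + 1 = k ∧ k ≤ m + 3) ∨ (i.val = m + 2 ∧ k = m + 4)
      then RatFunc.X / d k else 0)]
    obtain ⟨i, hi⟩ := i
    simp only
    rw [← Finset.sum_filter]
    set S := (Finset.range (m + 4 + 1)).filter fun k => (i = 2 ∧ k < 2) ∨
      (2 ≤ i ∧ i + 1 = k ∧ k ≤ m + 3) ∨ (i = m + 2 ∧ k = m + 4) with hS
    by_cases hl : i < 2 ∨ m + 3 ≤ i
    · have : S = ∅ := by
        ext k; simp [hS]; omega
      rw [this, Finset.sum_empty, hleaf i hl, add_zero]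
    by_cases hi2 : i = 2
    · subst hi2
      rw [hroot]
      have e3 := hf0 3
      rcases Nat.eq_zero_or_pos m with rfl | hm
      · have : S = {0, 1, 3, 4} := by
          ext k; simp [hS]; omega
        rw [this]
        simp [hleaf, hf]
        field_simp
        ring
      · have : S = {0, 1, 3} := by
          ext k; simp [hS]; omega
        rw [this]
        have e4 := hf0 4
        rw [Finset.sum_insert (by simp), Finset.sum_pair (by simp), hleaf 0 (by omega),
          hleaf 1 (by omega), hchain 3 le_rfl (by omega)]
        field_simp
        obtain ⟨e, rfl⟩ : ∃ e, m = e + 1 := ⟨m - 1, by omega⟩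
        simp only [hf, show e + 1 + 4 - 3 = e + 2 by omega,
          show e + 1 + 4 - (3 + 1) = e + 1 by omega]
        ring
    · by_cases hm : i = m + 2
      · subst hm
        have : S = {m + 3, m + 4} := by
          ext k; simp [hS]; omega
        rw [this, Finset.sum_pair (by omega), hleaf (m + 3) (by omega), hleaf (m + 4) (by omega),
          hchain (m + 2) (by omega) (by omega)]
        simp only [hf, show m + 4 - (m + 2) = 2 by omega, show m + 4 - (m + 2 + 1) = 1 by omega,
          pow_one]
        field_simp
        ring
      · have : S = {i + 1} := by
          ext k; simp [hS]; omega
        rw [this, Finset.sum_singleton, hchain i (by omega) (by omega),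
          hchain (i + 1) (by omega) (by omega)]
        obtain ⟨e, he⟩ : ∃ e, i + e = m + 1 := ⟨m + 1 - i, by omega⟩
        have e0 := hf0 i
        have e1 := hf0 (i + 1)
        have e2 := hf0 (i + 1 + 1)
        field_simp
        simp only [hf, show m + 4 - i = e + 3 by omega,
          show m + 4 - (i + 1) = e + 2 by omega,
          show m + 4 - (i + 1 + 1) = e + 1 by omega]
        ring

/-- Theorem 2 for type `D_l` (`l ≥ 4`): any Coxeter element `c` of the Cartan matrix of
type `D_l` and any affine Coxeter element `c_a` of the affine Cartan matrix of type
`D_l^{(1)}` (products of the simple reflections in any fixed order) satisfy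
`det(tI - c) = (t^{l-1} + 1)(t + 1)`, `det(tI - c_a)·(t - 1) = (t² - 1)²(t^{l-2} - 1)`,
and the Poincaré series `p(t) = (1-t^{2(l-1)})/((1-t²)(1-t^{l-2})(1-t^{l-1}))` of the
Kleinian singularity of type `D_l` equals `det(tI - c)/det(tI - c_a)` as a rational
function. -/
theorem poincare_series_D (l : ℕ) (hl : 4 ≤ l)
    (σ : Equiv.Perm (Fin l)) (τ : Equiv.Perm (Fin (l + 1)))
    (c : Matrix (Fin l) (Fin l) ℚ)
    (hc : c = (List.ofFn fun k => simpleRefl (cartanD l) (σ k)).prod)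
    (ca : Matrix (Fin (l + 1)) (Fin (l + 1)) ℚ)
    (hca : ca = (List.ofFn fun k => simpleRefl (cartanDAffine l) (τ k)).prod) :
    c.charpoly = (X ^ (l - 1) + 1) * (X + 1) ∧
    ca.charpoly * (X - 1) = (X ^ 2 - 1) ^ 2 * (X ^ (l - 2) - 1) ∧
    (1 - RatFunc.X ^ (2 * (l - 1))) /
        ((1 - RatFunc.X ^ 2) * (1 - RatFunc.X ^ (l - 2)) * (1 - RatFunc.X ^ (l - 1)))
      = algebraMap (Polynomial ℚ) (RatFunc ℚ) c.charpoly /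
        algebraMap (Polynomial ℚ) (RatFunc ℚ) ca.charpoly := by
  obtain ⟨m, rfl⟩ : ∃ m, l = m + 4 := ⟨l - 4, by omega⟩
  have hφ := charpoly_coxeter_D m σ
  have hψ := charpoly_coxeter_D_affine m τ
  rw [← hc] at hφ
  rw [← hca] at hψ
  have hinj := IsFractionRing.injective ℚ[X] (RatFunc ℚ)
  simp only [show m + 4 - 1 = m + 3 by omega, show m + 4 - 2 = m + 2 by omega]
  refine ⟨hinj ?_, hinj ?_, ?_⟩
  · simp [hφ]
  · simp only [map_mul, map_sub, map_pow, map_one, RatFunc.algebraMap_X, hψ]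
    ring
  · rw [hφ, hψ]
    have h1 : (RatFunc.X + 1 : RatFunc ℚ) ≠ 0 := by simpa using ratFunc_X_pow_add_one_ne_zero 1
    have h2 : (RatFunc.X - 1 : RatFunc ℚ) ≠ 0 := by
      simpa using ratFunc_X_pow_sub_one_ne_zero one_ne_zero
    have h3 := ratFunc_X_pow_sub_one_ne_zero (n := m + 2) (by omega)
    have h4 := ratFunc_X_pow_sub_one_ne_zero (n := m + 3) (by omega)
    have h5 := ratFunc_X_pow_sub_one_ne_zero two_ne_zero
    have hneg (a : RatFunc ℚ) (ha : a - 1 ≠ 0) : 1 - a ≠ 0 := fun h => ha (by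
      rw [← neg_sub, h, neg_zero])
    rw [div_eq_div_iff (mul_ne_zero (mul_ne_zero (hneg _ h5) (hneg _ h3)) (hneg _ h4))
      (mul_ne_zero (mul_ne_zero (pow_ne_zero 2 h1) h2) h3)]
    ring
end

section
/- Let C be the Cartan matrix of type E₆ and C̃ the affine Cartan matrix of type E₆^{(1)} (size 7). Define simple reflections by s_i(e_j) = e_j − c_{ij} e_i in the respective standard bases, let c be the product of the 6 simple reflections of C (any fixed order) and c_a the product of the 7 simple reflections of C̃ (any fixed order). Then det(t·I − c)·(1−t)(1−t⁴)(1−t⁶) = (1−t²)(1−t³)(1−t^{12}), det(t·I − c_a)·(1−t) = (1−t²)(1−t³)², and consequently the Poincaré series p(t) = (1−t^{12})/((1−t³)(1−t⁴)(1−t⁶)) of the Kleinian singularity of type E₆ satisfies p(t) = det(t·I − c)/det(t·I − c_a) as rational functions. -/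
open Polynomial

/-- The Cartan matrix of type `E₆` over `ℚ`. -/
def cartanE6 : Matrix (Fin 6) (Fin 6) ℚ :=
  (CartanMatrix.E₆).map fun x => (x : ℚ)

/-- The affine Cartan matrix of type `E₆⁽¹⁾` (size 7): the `E₆` diagram with an extra
vertex (index 6) attached to the branch vertex's neighbour (index 1). -/
def cartanE6Affine : Matrix (Fin 7) (Fin 7) ℚ :=
  !![2, 0, -1, 0, 0, 0, 0;
     0, 2, 0, -1, 0, 0, -1;
     -1, 0, 2, -1, 0, 0, 0;
     0, -1, -1, 2, -1, 0, 0;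
     0, 0, 0, -1, 2, -1, 0;
     0, 0, 0, 0, -1, 2, 0;
     0, -1, 0, 0, 0, 0, 2]

/-- The part of `C` weakly above the diagonal for the order in which `σ` lists the indices,
with diagonal entries replaced by `1`. -/
def unipotentUpper {N : ℕ} (C : Matrix (Fin N) (Fin N) ℚ) (σ : Equiv.Perm (Fin N)) :
    Matrix (Fin N) (Fin N) ℚ :=
  Matrix.of fun i j => if i = j then 1 else if σ.symm i < σ.symm j then C i j else 0

/-- The part of `C` weakly below the diagonal for the order in which `σ` lists the indices,
with diagonal entries replaced by `1`. -/
def unipotentLower {N : ℕ} (C : Matrix (Fin N) (Fin N) ℚ) (σ : Equiv.Perm (Fin N)) :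
    Matrix (Fin N) (Fin N) ℚ :=
  Matrix.of fun i j => if i = j then 1 else if σ.symm j < σ.symm i then C i j else 0

theorem simpleRefl_mul_apply {N : ℕ} (C P : Matrix (Fin N) (Fin N) ℚ) (i k j : Fin N) :
    (simpleRefl C i * P) k j = P k j - if k = i then (C * P) i j else 0 := by
  have h : simpleRefl C i = 1 - Matrix.of fun k j => if k = i then C i j else 0 := by
    ext k j
    simp [simpleRefl, Matrix.one_apply]
  rw [h, sub_mul, one_mul, Matrix.sub_apply]
  congr 1
  split_ifs with hk <;> simp [Matrix.mul_apply, hk]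

/-- A product of simple reflections leaves the coordinates outside the list unchanged, and, when
the list exhausts a final segment of the order, its rows satisfy the unitriangular system. -/
theorem simpleRefl_prod_rows {N : ℕ} (C : Matrix (Fin N) (Fin N) ℚ) (hC : ∀ i, C i i = 2)
    (σ : Equiv.Perm (Fin N)) (l : List (Fin N))
    (hl : l.Pairwise fun i j => σ.symm i < σ.symm j)
    (hup : ∀ i ∈ l, ∀ j, σ.symm i < σ.symm j → j ∈ l) :
    (∀ i, i ∉ l → ∀ j, (l.map (simpleRefl C)).prod i j = (1 : Matrix _ _ ℚ) i j) ∧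
    ∀ i ∈ l, ∀ j, (unipotentUpper C σ * (l.map (simpleRefl C)).prod) i j
      = -unipotentLower C σ i j := by
  induction l with
  | nil => simp
  | cons a l ih =>
    rw [List.pairwise_cons] at hl
    have hmem : ∀ j, j ∈ l ↔ σ.symm a < σ.symm j := fun j =>
      ⟨hl.1 j, fun h => (List.mem_cons.1 (hup a (by simp) j h)).resolve_left
        (by rintro rfl; exact lt_irrefl _ h)⟩
    obtain ⟨ih₁, ih₂⟩ := ih hl.2 fun i hi j hij => (hmem j).2 ((hl.1 i hi).trans hij)
    have ha : a ∉ l := fun h => lt_irrefl _ (hl.1 a h)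
    rw [List.map_cons, List.prod_cons]
    set P := (l.map (simpleRefl C)).prod with hP
    refine ⟨fun i hi j => ?_, fun i hi j => ?_⟩
    · rw [List.mem_cons, not_or] at hi
      rw [simpleRefl_mul_apply, if_neg hi.1, sub_zero, ih₁ i hi.2]
    have hrow : ∀ k, k ≠ a → (simpleRefl C a * P) k j = P k j := fun k hk => by
      rw [simpleRefl_mul_apply, if_neg hk, sub_zero]
    rcases List.mem_cons.1 hi with rfl | hil
    · have key : ∀ k, unipotentUpper C σ i k * (simpleRefl C i * P) k j
          = (C i k * P k j - C i k * (if σ.symm k ≤ σ.symm i then (1 : Matrix _ _ ℚ) k j else 0))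
            + if k = i then (simpleRefl C i * P) i j else 0 := by
        intro k
        by_cases hk : k = i
        · subst hk
          simp [unipotentUpper, ih₁ k ha j]
        · rw [hrow k hk]
          rcases lt_or_gt_of_ne (fun h => hk (σ.symm.injective h)) with h | h
          · have : k ∉ l := fun h' => lt_asymm h ((hmem k).1 h')
            simp [unipotentUpper, hk, Ne.symm hk, h.le, h.not_gt, ih₁ k this j]
          · simp [unipotentUpper, hk, Ne.symm hk, h, h.not_ge]
      rw [Matrix.mul_apply, Finset.sum_congr rfl fun k _ => key k, Finset.sum_add_distrib,
        Finset.sum_sub_distrib, ← Matrix.mul_apply, simpleRefl_mul_apply, ih₁ i ha]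
      simp only [Finset.sum_ite_eq', Finset.mem_univ, if_true, Matrix.one_apply]
      rw [Finset.sum_eq_single j]
      · by_cases h : i = j
        · subst h; simp [unipotentLower, hC]; ring
        · have : σ.symm j ≠ σ.symm i := fun h' => h (σ.symm.injective h').symm
          simp [unipotentLower, h, le_iff_lt_or_eq]
          grind
      · intro k _ hk
        simp [hk]
      · simp
    · rw [← ih₂ i hil j, Matrix.mul_apply, Matrix.mul_apply]
      refine Finset.sum_congr rfl fun k _ => ?_
      by_cases hk : k = a
      · have h := hl.1 i hil
        have hia : i ≠ a := by rintro rfl; exact ha hil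
        simp [unipotentUpper, hk, h.not_gt, hia]
      · rw [hrow k hk]

theorem unipotentUpper_mul_coxeter {N : ℕ} (C : Matrix (Fin N) (Fin N) ℚ)
    (hC : ∀ i, C i i = 2) (σ : Equiv.Perm (Fin N)) :
    unipotentUpper C σ * (List.ofFn fun k => simpleRefl C (σ k)).prod = -unipotentLower C σ := by
  have h := (simpleRefl_prod_rows C hC σ (List.ofFn σ)
    (by simp [List.pairwise_ofFn]) (fun _ _ j _ => (List.mem_ofFn' _ _).2 (σ.surjective j))).2
  ext i j
  have h' := h i ((List.mem_ofFn' _ _).2 (σ.surjective i)) j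
  rw [List.map_ofFn] at h'
  exact h'

theorem det_unipotentUpper {N : ℕ} (C : Matrix (Fin N) (Fin N) ℚ) (σ : Equiv.Perm (Fin N)) :
    (unipotentUpper C σ).det = 1 := by
  rw [← Matrix.det_submatrix_equiv_self σ, Matrix.det_of_isUpperTriangular]
  · simp [unipotentUpper]
  · intro i j hij
    have hij : j < i := hij
    simp [unipotentUpper, hij.ne', hij.not_gt]

/-- The characteristic polynomial of a Coxeter element is that of the pencil attached to the
splitting of the Cartan matrix into unitriangular parts. -/
theorem charpoly_coxeter {N : ℕ} (C : Matrix (Fin N) (Fin N) ℚ)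
    (hC : ∀ i, C i i = 2) (σ : Equiv.Perm (Fin N)) :
    (List.ofFn fun k => simpleRefl C (σ k)).prod.charpoly
      = (Matrix.of fun i j => if i = j then X + 1 else
          (if σ.symm i < σ.symm j then X else 1) * Polynomial.C (C i j)).det := by
  set c := (List.ofFn fun k => simpleRefl C (σ k)).prod with hc
  have hU : ((unipotentUpper C σ).map (Polynomial.C : ℚ →+* ℚ[X])).det = 1 := by
    rw [← RingHom.mapMatrix_apply, ← RingHom.map_det, det_unipotentUpper, map_one]
  have hdet : c.charpoly
      = ((unipotentUpper C σ).map (Polynomial.C : ℚ →+* ℚ[X]) * c.charmatrix).det := by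
    rw [Matrix.det_mul, hU, one_mul, Matrix.charpoly]
  rw [hdet, Matrix.charmatrix, mul_sub, RingHom.mapMatrix_apply, ← Matrix.map_mul, hc,
    unipotentUpper_mul_coxeter C hC]
  congr 1
  ext1 i j
  rw [Matrix.sub_apply, (Matrix.scalar_commute X (fun _ => Commute.all _ _) _).symm.eq]
  simp only [Matrix.scalar_apply, Matrix.diagonal_mul, Matrix.map_apply, Matrix.neg_apply,
    Matrix.of_apply, unipotentUpper, unipotentLower]
  by_cases h : i = j
  · simp [h]
  · rcases lt_or_gt_of_ne (fun h' => h (σ.symm.injective h')) with h' | h'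
    · simp [h, h', h'.not_gt]
    · simp [h, h', h'.not_gt]

theorem ite_lt_mul_ite_gt {N : ℕ} (σ : Equiv.Perm (Fin N)) {i j : Fin N} (h : i ≠ j) :
    (if σ.symm i < σ.symm j then (X : ℚ[X]) else 1) * (if σ.symm j < σ.symm i then X else 1)
      = X := by
  rcases lt_or_gt_of_ne (fun h' => h (σ.symm.injective h')) with h' | h' <;>
    simp [h', h'.not_gt]

theorem det_E6_pencil {R : Type*} [CommRing R] (d t a₀ b₀ a₁ b₁ a₂ b₂ a₃ b₃ a₄ b₄ : R)
    (h₀ : a₀ * b₀ = t) (h₁ : a₁ * b₁ = t) (h₂ : a₂ * b₂ = t) (h₃ : a₃ * b₃ = t)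
    (h₄ : a₄ * b₄ = t) :
    !![d, 0, -a₀, 0, 0, 0;
       0, d, 0, -a₁, 0, 0;
       -b₀, 0, d, -a₂, 0, 0;
       0, -b₁, -b₂, d, -a₃, 0;
       0, 0, 0, -b₃, d, -a₄;
       0, 0, 0, 0, -b₄, d].det = d ^ 6 - 5 * d ^ 4 * t + 5 * d ^ 2 * t ^ 2 - t ^ 3 := by
  simp [Matrix.det_succ_row_zero, Fin.sum_univ_succ, Fin.succAbove]
  grind

theorem charpoly_coxeter_E6 (σ : Equiv.Perm (Fin 6)) :
    (List.ofFn fun k => simpleRefl cartanE6 (σ k)).prod.charpoly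
      = (X + 1) ^ 6 - 5 * (X + 1) ^ 4 * X + 5 * (X + 1) ^ 2 * X ^ 2 - X ^ 3 := by
  rw [charpoly_coxeter cartanE6 (fun i => by fin_cases i <;> simp [cartanE6, CartanMatrix.E₆])]
  rw [← det_E6_pencil (X + 1 : ℚ[X]) X _ _ _ _ _ _ _ _ _ _
    (ite_lt_mul_ite_gt σ (i := 0) (j := 2) (by decide))
    (ite_lt_mul_ite_gt σ (i := 1) (j := 3) (by decide))
    (ite_lt_mul_ite_gt σ (i := 2) (j := 3) (by decide))
    (ite_lt_mul_ite_gt σ (i := 3) (j := 4) (by decide))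
    (ite_lt_mul_ite_gt σ (i := 4) (j := 5) (by decide))]
  congr 1
  ext1 i j
  fin_cases i <;> fin_cases j <;> simp [cartanE6, CartanMatrix.E₆, -ite_mul]

theorem det_E6_affine_pencil {R : Type*} [CommRing R]
    (d t a₀ b₀ a₁ b₁ a₂ b₂ a₃ b₃ a₄ b₄ a₅ b₅ : R)
    (h₀ : a₀ * b₀ = t) (h₁ : a₁ * b₁ = t) (h₂ : a₂ * b₂ = t) (h₃ : a₃ * b₃ = t)
    (h₄ : a₄ * b₄ = t) (h₅ : a₅ * b₅ = t) :
    !![d, 0, -a₀, 0, 0, 0, 0;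
       0, d, 0, -a₁, 0, 0, -a₅;
       -b₀, 0, d, -a₂, 0, 0, 0;
       0, -b₁, -b₂, d, -a₃, 0, 0;
       0, 0, 0, -b₃, d, -a₄, 0;
       0, 0, 0, 0, -b₄, d, 0;
       0, -b₅, 0, 0, 0, 0, d].det
      = d ^ 7 - 6 * d ^ 5 * t + 9 * d ^ 3 * t ^ 2 - 4 * d * t ^ 3 := by
  simp [Matrix.det_succ_row_zero, Fin.sum_univ_succ, Fin.succAbove]
  grind

theorem charpoly_coxeter_E6_affine (σ : Equiv.Perm (Fin 7)) :
    (List.ofFn fun k => simpleRefl cartanE6Affine (σ k)).prod.charpoly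
      = (X + 1) ^ 7 - 6 * (X + 1) ^ 5 * X + 9 * (X + 1) ^ 3 * X ^ 2 - 4 * (X + 1) * X ^ 3 := by
  rw [charpoly_coxeter cartanE6Affine (fun i => by fin_cases i <;> simp [cartanE6Affine])]
  rw [← det_E6_affine_pencil (X + 1 : ℚ[X]) X _ _ _ _ _ _ _ _ _ _ _ _
    (ite_lt_mul_ite_gt σ (i := 0) (j := 2) (by decide))
    (ite_lt_mul_ite_gt σ (i := 1) (j := 3) (by decide))
    (ite_lt_mul_ite_gt σ (i := 2) (j := 3) (by decide))
    (ite_lt_mul_ite_gt σ (i := 3) (j := 4) (by decide))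
    (ite_lt_mul_ite_gt σ (i := 4) (j := 5) (by decide))
    (ite_lt_mul_ite_gt σ (i := 1) (j := 6) (by decide))]
  congr 1
  ext1 i j
  fin_cases i <;> fin_cases j <;> simp [cartanE6Affine, -ite_mul]

/-- `1 - X ^ n` does not vanish as a rational function for `n ≠ 0`. -/
theorem one_sub_ratFuncX_pow_ne_zero {n : ℕ} (hn : n ≠ 0) :
    (1 - RatFunc.X ^ n : RatFunc ℚ) ≠ 0 := by
  have h : (1 - X ^ n : ℚ[X]) ≠ 0 := fun h => by
    simpa [hn] using congrArg (Polynomial.eval 0) h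
  simpa using (map_ne_zero_iff _ (RatFunc.algebraMap_injective ℚ)).2 h

/-- Theorem 2 for type `E₆`: any Coxeter element `c` (product of the 6 simple
reflections of the `E₆` Cartan matrix in any fixed order) and any affine Coxeter
element `c_a` (product of the 7 simple reflections of the affine `E₆⁽¹⁾` Cartan matrix
in any fixed order) satisfy
`det(tI-c)·(1-t)(1-t⁴)(1-t⁶) = (1-t²)(1-t³)(1-t¹²)`,
`det(tI-c_a)·(1-t) = (1-t²)(1-t³)²`, and the Poincaré series
`p(t) = (1-t¹²)/((1-t³)(1-t⁴)(1-t⁶))` of the Kleinian singularity of type `E₆` equals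
`det(tI-c)/det(tI-c_a)` as a rational function. -/
theorem poincare_series_E6
    (σ : Equiv.Perm (Fin 6)) (τ : Equiv.Perm (Fin 7))
    (c : Matrix (Fin 6) (Fin 6) ℚ)
    (hc : c = (List.ofFn fun k => simpleRefl cartanE6 (σ k)).prod)
    (ca : Matrix (Fin 7) (Fin 7) ℚ)
    (hca : ca = (List.ofFn fun k => simpleRefl cartanE6Affine (τ k)).prod) :
    c.charpoly * ((1 - X) * (1 - X ^ 4) * (1 - X ^ 6))
      = (1 - X ^ 2) * (1 - X ^ 3) * (1 - X ^ 12) ∧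
    ca.charpoly * (1 - X) = (1 - X ^ 2) * (1 - X ^ 3) ^ 2 ∧
    (1 - RatFunc.X ^ 12) /
        ((1 - RatFunc.X ^ 3) * (1 - RatFunc.X ^ 4) * (1 - RatFunc.X ^ 6))
      = algebraMap (Polynomial ℚ) (RatFunc ℚ) c.charpoly /
        algebraMap (Polynomial ℚ) (RatFunc ℚ) ca.charpoly := by
  subst hc hca
  rw [charpoly_coxeter_E6, charpoly_coxeter_E6_affine]
  refine ⟨by ring, by ring, ?_⟩
  rw [div_eq_div_iff]
  · simp only [map_add, map_sub, map_mul, map_pow, map_one, map_ofNat, RatFunc.algebraMap_X]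
    ring
  · exact mul_ne_zero (mul_ne_zero (one_sub_ratFuncX_pow_ne_zero (by norm_num))
      (one_sub_ratFuncX_pow_ne_zero (by norm_num))) (one_sub_ratFuncX_pow_ne_zero (by norm_num))
  · rw [map_ne_zero_iff _ (RatFunc.algebraMap_injective ℚ), ← charpoly_coxeter_E6_affine τ]
    exact (Matrix.charpoly_monic _).ne_zero
end
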